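/- (Hyperbolic case, normal-vector characterization.) Let γ(t) = Ψ(u(t), v(t)) be a nondegenerate curve on [a,b] with cosh(u(t)) sin(v(t)) > 0 and cosh(u(t)) sin(v(t)) + λ ≠ 0 for all t. Then γ is a critical point of the energy with density ρ(u,v) = cosh(u) sin(v) + λ (a catenary with respect to the plane {y = 0}) if and only if its geodesic curvature satisfies κ(t) = − ⟨n(t), Y⟩ / ( d(t) + λ ) for all t, where Y = (0,1,0), n is the principal normal of γ, and d(t) = cosh(u(t)) sin(v(t)) is the distance from γ(t) to the plane {y = 0}. -/

import Mathlib

noncomputable section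

open Real

/-- Lorentzian inner product on `ℝ³`: `⟨p,q⟩ = p₁q₁ + p₂q₂ − p₃q₃`. -/
def lprod (p q : Fin 3 → ℝ) : ℝ := p 0 * q 0 + p 1 * q 1 - p 2 * q 2

/-- Determinant of the 3×3 matrix with rows `a`, `b`, `c`. -/
def det3 (a b c : Fin 3 → ℝ) : ℝ :=
  a 0 * (b 1 * c 2 - b 2 * c 1) - a 1 * (b 0 * c 2 - b 2 * c 0)
    + a 2 * (b 0 * c 1 - b 1 * c 0)

/-- Parametrization `Ψ` of the de Sitter plane `S₁² ⊂ L³`. -/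
def Psi (u v : ℝ) : Fin 3 → ℝ :=
  ![Real.cosh u * Real.cos v, Real.cosh u * Real.sin v, Real.sinh u]

/-- Lorentzian cross product, characterized by `lprod (lcross a b) c = det3 a b c`. -/
def lcross (a b : Fin 3 → ℝ) : Fin 3 → ℝ :=
  ![a 1 * b 2 - a 2 * b 1, a 2 * b 0 - a 0 * b 2, a 1 * b 0 - a 0 * b 1]

/-- The curve `t ↦ Ψ(u t, v t)`, restricted to `[a, b]`, is a critical point of the
energy `E[γ] = ∫ₐᵇ ρ(u(t), v(t)) |γ'(t)| dt` among variations fixing the endpoints. -/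
def IsCritical (ρ : ℝ → ℝ → ℝ) (ε : ℝ) (u v : ℝ → ℝ) (a b : ℝ) : Prop :=
  ∀ φ ψ : ℝ → ℝ, ContDiff ℝ (⊤ : ℕ∞) φ → ContDiff ℝ (⊤ : ℕ∞) ψ →
    φ a = 0 → φ b = 0 → ψ a = 0 → ψ b = 0 →
    deriv (fun s : ℝ => ∫ t in a..b,
      ρ (u t + s * φ t) (v t + s * ψ t) *
        Real.sqrt (ε * ((deriv v t + s * deriv ψ t) ^ 2 *
          Real.cosh (u t + s * φ t) ^ 2 - (deriv u t + s * deriv φ t) ^ 2))) 0 = 0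

section Helpers

open Set Filter Topology MeasureTheory intervalIntegral

/-- Differentiation under the integral sign for an integrand that is continuously differentiable
in the parameter on a neighbourhood of `{x₀} × [a, b]`. -/
lemma hasDerivAt_intervalIntegral_of_continuousOn {a b x₀ : ℝ} (hab : a ≤ b)
    {F F' : ℝ → ℝ → ℝ} {U : Set (ℝ × ℝ)} (hU : IsOpen U) (hx₀ : ∀ t ∈ Icc a b, (x₀, t) ∈ U)
    (hF : ContinuousOn (Function.uncurry F) U) (hF' : ContinuousOn (Function.uncurry F') U)
    (hderiv : ∀ x t, (x, t) ∈ U → HasDerivAt (fun y => F y t) (F' x t) x) :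
    HasDerivAt (fun x => ∫ t in a..b, F x t) (∫ t in a..b, F' x₀ t) x₀ := by
  obtain ⟨V, W, hV, -, hxV, hW, hVW⟩ := generalized_tube_lemma (isCompact_singleton (x := x₀))
    (isCompact_Icc (a := a) (b := b)) hU (by
      rintro ⟨x, t⟩ ⟨rfl, ht⟩
      exact hx₀ t ht)
  obtain ⟨r, hr, hrV⟩ := Metric.nhds_basis_closedBall.mem_iff.1
    (hV.mem_nhds (singleton_subset_iff.1 hxV))
  have hK : Metric.closedBall x₀ r ×ˢ Icc a b ⊆ U := (prod_mono hrV hW).trans hVW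
  obtain ⟨C, hC⟩ := ((isCompact_closedBall x₀ r).prod
    (isCompact_Icc (a := a) (b := b))).exists_bound_of_continuousOn (hF'.mono hK)
  have slice : ∀ {G : ℝ → ℝ → ℝ}, ContinuousOn (Function.uncurry G) U →
      ∀ x ∈ Metric.closedBall x₀ r, IntervalIntegrable (G x) volume a b := by
    intro G hG x hx
    refine ContinuousOn.intervalIntegrable_of_Icc hab ?_
    exact (hG.mono hK).comp (f := fun t => (x, t)) (by fun_prop) fun t ht => ⟨hx, ht⟩
  have hmem : ∀ {t}, t ∈ uIoc a b → t ∈ Icc a b := by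
    intro t ht
    rw [uIoc_of_le hab] at ht
    exact Ioc_subset_Icc_self ht
  have hself : x₀ ∈ Metric.closedBall x₀ r := Metric.mem_closedBall_self hr.le
  refine (intervalIntegral.hasDerivAt_integral_of_dominated_loc_of_deriv_le (bound := fun _ => C)
    (Metric.closedBall_mem_nhds x₀ hr) ?_ (slice hF x₀ hself)
    (intervalIntegrable_iff.1 (slice hF' x₀ hself)).aestronglyMeasurable ?_ intervalIntegrable_const ?_).2
  · filter_upwards [Metric.closedBall_mem_nhds x₀ hr] with x hx
    exact (intervalIntegrable_iff.1 (slice hF x hx)).aestronglyMeasurable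
  · exact ae_of_all _ fun t ht x hx => hC (x, t) ⟨hx, hmem ht⟩
  · exact ae_of_all _ fun t ht x hx => hderiv x t (hK ⟨hx, hmem ht⟩)

/-- The fundamental lemma of the calculus of variations on `[a, b]`. -/
lemma eq_zero_on_Icc_of_integral_smooth_mul_eq_zero {a b : ℝ} (hab : a < b) {f : ℝ → ℝ}
    (hf : ContinuousOn f (Icc a b))
    (h : ∀ g : ℝ → ℝ, ContDiff ℝ (⊤ : ℕ∞) g → g a = 0 → g b = 0 →
      ∫ t in a..b, g t * f t = 0) :
    ∀ t ∈ Icc a b, f t = 0 := by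
  have hae : ∀ᵐ t ∂(volume : Measure ℝ), t ∈ Ioo a b → f t = 0 := by
    refine IsOpen.ae_eq_zero_of_integral_contDiff_smul_eq_zero isOpen_Ioo
      ((hf.mono Ioo_subset_Icc_self).locallyIntegrableOn measurableSet_Ioo) ?_
    intro g hg _ hsupp
    have hzero : ∀ t, t ∉ Ioo a b → g t = 0 := fun t ht =>
      image_eq_zero_of_notMem_tsupport fun h' => ht (hsupp h')
    rw [← h g hg (hzero a (by simp)) (hzero b (by simp)), integral_of_le hab.le,
      setIntegral_eq_integral_of_forall_compl_eq_zero]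
    · rfl
    · intro t ht
      rw [hzero t fun h' => ht (Ioo_subset_Ioc_self h'), zero_mul]
  refine Measure.eqOn_Icc_of_ae_eq volume hab.ne (g := fun _ => 0) ?_ hf continuousOn_const
  rw [← restrict_Ioo_eq_restrict_Icc]
  exact (ae_restrict_iff' measurableSet_Ioo).2 hae

/-- The squared speed of a curve in the de Sitter plane with coordinate velocity `(p, q)`. -/
def speedSq (ε u p q : ℝ) : ℝ := ε * (q ^ 2 * cosh u ^ 2 - p ^ 2)

/-- The quantity `(d + λ) κ + ⟨n, Y⟩`, in coordinates. -/
def catenaryDefect (lam ε : ℝ) (u v : ℝ → ℝ) (t : ℝ) : ℝ :=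
  ((cosh (u t) * sin (v t) + lam) * ε *
      (cosh (u t) * (deriv v t * deriv (deriv u) t - deriv u t * deriv (deriv v) t)
        - 2 * sinh (u t) * deriv u t ^ 2 * deriv v t
        + cosh (u t) ^ 2 * sinh (u t) * deriv v t ^ 3) /
      speedSq ε (u t) (deriv u t) (deriv v t)
    + deriv u t * cos (v t) + sinh (u t) * cosh (u t) * deriv v t * sin (v t)) /
  sqrt (speedSq ε (u t) (deriv u t) (deriv v t))

variable {a b lam ε : ℝ} {u v φ ψ : ℝ → ℝ}

/-- The integrand of the first variation of the catenary energy at parameter `s`. -/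
def firstVariation (lam ε : ℝ) (u v φ ψ : ℝ → ℝ) (s t : ℝ) : ℝ :=
  (sinh (u t + s * φ t) * φ t * sin (v t + s * ψ t)
      + cosh (u t + s * φ t) * (cos (v t + s * ψ t) * ψ t)) *
    sqrt (speedSq ε (u t + s * φ t) (deriv u t + s * deriv φ t) (deriv v t + s * deriv ψ t))
  + (cosh (u t + s * φ t) * sin (v t + s * ψ t) + lam) *
    (ε * ((deriv v t + s * deriv ψ t) * deriv ψ t * cosh (u t + s * φ t) ^ 2
      + (deriv v t + s * deriv ψ t) ^ 2 * (cosh (u t + s * φ t) * sinh (u t + s * φ t) * φ t)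
      - (deriv u t + s * deriv φ t) * deriv φ t) /
    sqrt (speedSq ε (u t + s * φ t) (deriv u t + s * deriv φ t) (deriv v t + s * deriv ψ t)))

lemma hasDerivAt_energy (hab : a ≤ b) (hu : ContDiff ℝ (⊤ : ℕ∞) u) (hv : ContDiff ℝ (⊤ : ℕ∞) v)
    (hφ : ContDiff ℝ (⊤ : ℕ∞) φ) (hψ : ContDiff ℝ (⊤ : ℕ∞) ψ)
    (hnd : ∀ t ∈ Icc a b, 0 < speedSq ε (u t) (deriv u t) (deriv v t)) :
    HasDerivAt (fun s : ℝ => ∫ t in a..b, (cosh (u t + s * φ t) * sin (v t + s * ψ t) + lam) *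
        sqrt (speedSq ε (u t + s * φ t) (deriv u t + s * deriv φ t) (deriv v t + s * deriv ψ t)))
      (∫ t in a..b, firstVariation lam ε u v φ ψ 0 t) 0 := by
  have cu := hu.continuous
  have cv := hv.continuous
  have cφ := hφ.continuous
  have cψ := hψ.continuous
  have cu' := hu.continuous_deriv (by simp)
  have cv' := hv.continuous_deriv (by simp)
  have cφ' := hφ.continuous_deriv (by simp)
  have cψ' := hψ.continuous_deriv (by simp)
  have hQ : Continuous fun p : ℝ × ℝ => speedSq ε (u p.2 + p.1 * φ p.2)
      (deriv u p.2 + p.1 * deriv φ p.2) (deriv v p.2 + p.1 * deriv ψ p.2) := by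
    unfold speedSq
    fun_prop
  refine hasDerivAt_intervalIntegral_of_continuousOn hab
    (U := {p | 0 < speedSq ε (u p.2 + p.1 * φ p.2) (deriv u p.2 + p.1 * deriv φ p.2)
      (deriv v p.2 + p.1 * deriv ψ p.2)}) (isOpen_lt continuous_const hQ) ?_ ?_ ?_ ?_
  · intro t ht
    simpa using hnd t ht
  · refine Continuous.continuousOn ?_
    unfold Function.uncurry
    fun_prop
  · unfold Function.uncurry firstVariation
    refine ContinuousOn.add (Continuous.continuousOn (by fun_prop)) (ContinuousOn.mul
      (Continuous.continuousOn (by fun_prop)) (ContinuousOn.div (Continuous.continuousOn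
      (by fun_prop)) (Continuous.continuousOn (by fun_prop)) ?_))
    intro p hp
    exact (sqrt_pos.2 hp).ne'
  · intro s t hst
    have hlin : ∀ x y : ℝ, HasDerivAt (fun r : ℝ => x + r * y) y s := fun x y => by
      simpa using ((hasDerivAt_id s).mul_const y).const_add x
    have hst' : 0 < speedSq ε (u t + s * φ t) (deriv u t + s * deriv φ t)
      (deriv v t + s * deriv ψ t) := hst
    have hρ := ((hlin (u t) (φ t)).cosh.mul (hlin (v t) (ψ t)).sin).add_const lam
    have hspeed := (((((hlin (deriv v t) (deriv ψ t)).pow 2).mul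
      ((hlin (u t) (φ t)).cosh.pow 2)).sub ((hlin (deriv u t) (deriv φ t)).pow 2)).const_mul
      ε).sqrt (ne_of_gt hst')
    refine (hρ.mul hspeed).congr_deriv ?_
    simp only [firstVariation, speedSq, Pi.pow_apply, Pi.mul_apply, Pi.sub_apply]
    ring

lemma continuousOn_catenaryDefect (hu : ContDiff ℝ (⊤ : ℕ∞) u) (hv : ContDiff ℝ (⊤ : ℕ∞) v)
    (hnd : ∀ t ∈ Icc a b, 0 < speedSq ε (u t) (deriv u t) (deriv v t)) :
    ContinuousOn (catenaryDefect lam ε u v) (Icc a b) := by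
  have hu' : ContDiff ℝ (⊤ : ℕ∞) (deriv u) := hu.iterate_deriv 1
  have hv' : ContDiff ℝ (⊤ : ℕ∞) (deriv v) := hv.iterate_deriv 1
  have cu := hu.continuous
  have cv := hv.continuous
  have cu' := hu'.continuous
  have cv' := hv'.continuous
  have cu'' := hu'.continuous_deriv (by simp)
  have cv'' := hv'.continuous_deriv (by simp)
  have cQ : Continuous fun t => speedSq ε (u t) (deriv u t) (deriv v t) := by
    unfold speedSq
    fun_prop
  unfold catenaryDefect
  refine ContinuousOn.div ((ContinuousOn.div (Continuous.continuousOn (by fun_prop))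
    cQ.continuousOn fun t ht => (hnd t ht).ne').add (Continuous.continuousOn (by fun_prop)) |>.add
    (Continuous.continuousOn (by fun_prop))) cQ.sqrt.continuousOn
    fun t ht => (sqrt_pos.2 (hnd t ht)).ne'

lemma continuousOn_firstVariation (hu : ContDiff ℝ (⊤ : ℕ∞) u) (hv : ContDiff ℝ (⊤ : ℕ∞) v)
    (hφ : ContDiff ℝ (⊤ : ℕ∞) φ) (hψ : ContDiff ℝ (⊤ : ℕ∞) ψ)
    (hnd : ∀ t ∈ Icc a b, 0 < speedSq ε (u t) (deriv u t) (deriv v t)) :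
    ContinuousOn (firstVariation lam ε u v φ ψ 0) (Icc a b) := by
  have cu := hu.continuous
  have cv := hv.continuous
  have cφ := hφ.continuous
  have cψ := hψ.continuous
  have cu' := hu.continuous_deriv (by simp)
  have cv' := hv.continuous_deriv (by simp)
  have cφ' := hφ.continuous_deriv (by simp)
  have cψ' := hψ.continuous_deriv (by simp)
  unfold firstVariation speedSq
  refine ContinuousOn.add (Continuous.continuousOn (by fun_prop)) (ContinuousOn.mul
    (Continuous.continuousOn (by fun_prop)) (ContinuousOn.div (Continuous.continuousOn
    (by fun_prop)) (Continuous.continuousOn (by fun_prop)) ?_))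
  intro t ht
  simpa [speedSq] using (sqrt_pos.2 (hnd t ht)).ne'

/-- The first variation differs from its Euler–Lagrange form by an exact derivative. -/
lemma hasDerivAt_boundaryTerm (hu : ContDiff ℝ (⊤ : ℕ∞) u) (hv : ContDiff ℝ (⊤ : ℕ∞) v)
    (hφ : ContDiff ℝ (⊤ : ℕ∞) φ) (hψ : ContDiff ℝ (⊤ : ℕ∞) ψ) {t : ℝ}
    (hnd : 0 < speedSq ε (u t) (deriv u t) (deriv v t)) :
    HasDerivAt (fun t => (cosh (u t) * sin (v t) + lam) * (ε *
        (cosh (u t) ^ 2 * deriv v t * ψ t - deriv u t * φ t)) /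
        sqrt (speedSq ε (u t) (deriv u t) (deriv v t)))
      (firstVariation lam ε u v φ ψ 0 t -
        -ε * cosh (u t) * (deriv u t * ψ t - deriv v t * φ t) * catenaryDefect lam ε u v t) t := by
  have hu' : ContDiff ℝ (⊤ : ℕ∞) (deriv u) := hu.iterate_deriv 1
  have hv' : ContDiff ℝ (⊤ : ℕ∞) (deriv v) := hv.iterate_deriv 1
  have du := (hu.differentiable (by simp) t).hasDerivAt
  have dv := (hv.differentiable (by simp) t).hasDerivAt
  have dφ := (hφ.differentiable (by simp) t).hasDerivAt
  have dψ := (hψ.differentiable (by simp) t).hasDerivAt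
  have du' := (hu'.differentiable (by simp) t).hasDerivAt
  have dv' := (hv'.differentiable (by simp) t).hasDerivAt
  have dspeed := ((((dv'.fun_pow 2).fun_mul (du.cosh.fun_pow 2)).fun_sub
    (du'.fun_pow 2)).const_mul ε).sqrt hnd.ne'
  have dG := (((du.cosh.fun_mul dv.sin).add_const lam).fun_mul
    ((((du.cosh.fun_pow 2).fun_mul dv' |>.fun_mul dψ).fun_sub
      (du'.fun_mul dφ)).const_mul ε)).fun_div dspeed (sqrt_pos.2 hnd).ne'
  refine dG.congr_deriv ?_
  simp only [firstVariation, catenaryDefect, zero_mul, add_zero]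
  have hW : sqrt (speedSq ε (u t) (deriv u t) (deriv v t)) ^ 2 =
      ε * (deriv v t ^ 2 * cosh (u t) ^ 2 - deriv u t ^ 2) := sq_sqrt hnd.le
  have hQ := hW.symm
  have hW0 := (sqrt_pos.2 hnd).ne'
  change speedSq ε (u t) (deriv u t) (deriv v t) = _ at hQ
  rw [show ε * (deriv v t ^ 2 * cosh (u t) ^ 2 - deriv u t ^ 2) =
    speedSq ε (u t) (deriv u t) (deriv v t) from rfl]
  generalize sqrt (speedSq ε (u t) (deriv u t) (deriv v t)) = W at *
  rw [hQ]
  generalize deriv (deriv u) t = u₂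
  generalize deriv (deriv v) t = v₂
  generalize deriv φ t = φ₁
  generalize deriv ψ t = ψ₁
  generalize deriv u t = u₁ at *
  generalize deriv v t = v₁ at *
  generalize φ t = φ₀
  generalize ψ t = ψ₀
  generalize cosh (u t) = C at *
  generalize sinh (u t) = S
  generalize cos (v t) = c
  generalize sin (v t) = s
  field_simp
  norm_num
  linear_combination 2 * ((S * u₁ * s + C * c * v₁) * ε * (C ^ 2 * v₁ * ψ₀ - u₁ * φ₀)
    + (C * s + lam) * ε * (2 * C * S * u₁ * v₁ * ψ₀ + C ^ 2 * v₂ * ψ₀ + C ^ 2 * v₁ * ψ₁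
      - u₂ * φ₀ - u₁ * φ₁)
    - (S * s * φ₀ + C * c * ψ₀) * (W ^ 2 + ε * (v₁ ^ 2 * C ^ 2 - u₁ ^ 2))
    - (C * s + lam) * ε * (C ^ 2 * v₁ * ψ₁ + C * S * v₁ ^ 2 * φ₀ - u₁ * φ₁)
    - ε * C * (u₁ * ψ₀ - v₁ * φ₀) * (u₁ * c + S * C * v₁ * s)) * hW

lemma integral_firstVariation (hab : a ≤ b) (hu : ContDiff ℝ (⊤ : ℕ∞) u)
    (hv : ContDiff ℝ (⊤ : ℕ∞) v) (hφ : ContDiff ℝ (⊤ : ℕ∞) φ) (hψ : ContDiff ℝ (⊤ : ℕ∞) ψ)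
    (hnd : ∀ t ∈ Icc a b, 0 < speedSq ε (u t) (deriv u t) (deriv v t))
    (hφa : φ a = 0) (hφb : φ b = 0) (hψa : ψ a = 0) (hψb : ψ b = 0) :
    ∫ t in a..b, firstVariation lam ε u v φ ψ 0 t =
      ∫ t in a..b, -ε * cosh (u t) * (deriv u t * ψ t - deriv v t * φ t) *
        catenaryDefect lam ε u v t := by
  have i₁ := (continuousOn_firstVariation (lam := lam) hu hv hφ hψ
    hnd).intervalIntegrable_of_Icc (μ := volume) hab
  have i₂ : IntervalIntegrable (fun t => -ε * cosh (u t) * (deriv u t * ψ t - deriv v t * φ t) *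
      catenaryDefect lam ε u v t) volume a b := by
    have cu := hu.continuous
    have cφ := hφ.continuous
    have cψ := hψ.continuous
    have cu' := hu.continuous_deriv (by simp)
    have cv' := hv.continuous_deriv (by simp)
    exact (ContinuousOn.mul (Continuous.continuousOn (by fun_prop))
      (continuousOn_catenaryDefect hu hv hnd)).intervalIntegrable_of_Icc hab
  rw [← sub_eq_zero, ← integral_sub i₁ i₂, integral_eq_sub_of_hasDerivAt (fun t ht =>
    hasDerivAt_boundaryTerm hu hv hφ hψ (hnd t (uIcc_of_le hab ▸ ht))) (i₁.sub i₂)]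
  simp [hφa, hφb, hψa, hψb]

lemma hasDerivAt_Psi {p q : ℝ} {t : ℝ} (hu : HasDerivAt u p t) (hv : HasDerivAt v q t) :
    HasDerivAt (fun t => Psi (u t) (v t))
      ![sinh (u t) * p * cos (v t) + cosh (u t) * (-sin (v t) * q),
        sinh (u t) * p * sin (v t) + cosh (u t) * (cos (v t) * q), cosh (u t) * p] t := by
  rw [hasDerivAt_pi]
  intro i
  fin_cases i
  · exact hu.cosh.fun_mul hv.cos
  · exact hu.cosh.fun_mul hv.sin
  · exact hu.sinh

lemma catenaryDefect_eq (hu : ContDiff ℝ (⊤ : ℕ∞) u) (hv : ContDiff ℝ (⊤ : ℕ∞) v)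
    {γ : ℝ → Fin 3 → ℝ} (hγ : ∀ t, γ t = Psi (u t) (v t)) {t w : ℝ}
    (hw : w = sqrt (speedSq ε (u t) (deriv u t) (deriv v t)))
    (hnd : 0 < speedSq ε (u t) (deriv u t) (deriv v t)) :
    catenaryDefect lam ε u v t = (cosh (u t) * sin (v t) + lam) *
        (ε * det3 (γ t) (deriv γ t) (deriv (deriv γ) t) / w ^ 3) +
      lprod ((-(1 / w)) • lcross (γ t) (deriv γ t)) ![(0 : ℝ), 1, 0] := by
  have hu' : ContDiff ℝ (⊤ : ℕ∞) (deriv u) := hu.iterate_deriv 1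
  have hv' : ContDiff ℝ (⊤ : ℕ∞) (deriv v) := hv.iterate_deriv 1
  have du := fun t => (hu.differentiable (by simp) t).hasDerivAt
  have dv := fun t => (hv.differentiable (by simp) t).hasDerivAt
  have du' := (hu'.differentiable (by simp) t).hasDerivAt
  have dv' := (hv'.differentiable (by simp) t).hasDerivAt
  obtain rfl : γ = fun t => Psi (u t) (v t) := funext hγ
  have hd₁ := funext fun t => (hasDerivAt_Psi (du t) (dv t)).deriv
  have hd₂ : HasDerivAt (deriv fun t => Psi (u t) (v t))
      ![cosh (u t) * deriv u t ^ 2 * cos (v t) + sinh (u t) * deriv (deriv u) t * cos (v t)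
          - 2 * sinh (u t) * deriv u t * deriv v t * sin (v t)
          - cosh (u t) * cos (v t) * deriv v t ^ 2 - cosh (u t) * sin (v t) * deriv (deriv v) t,
        cosh (u t) * deriv u t ^ 2 * sin (v t) + sinh (u t) * deriv (deriv u) t * sin (v t)
          + 2 * sinh (u t) * deriv u t * deriv v t * cos (v t)
          - cosh (u t) * sin (v t) * deriv v t ^ 2 + cosh (u t) * cos (v t) * deriv (deriv v) t,
        sinh (u t) * deriv u t ^ 2 + cosh (u t) * deriv (deriv u) t] t := by
    rw [hd₁, hasDerivAt_pi]
    intro i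
    fin_cases i
    · refine ((((du t).sinh.fun_mul du').fun_mul (dv t).cos).fun_add
        ((du t).cosh.fun_mul ((dv t).sin.fun_neg.fun_mul dv'))).congr_deriv ?_
      simp
      ring
    · refine ((((du t).sinh.fun_mul du').fun_mul (dv t).sin).fun_add
        ((du t).cosh.fun_mul ((dv t).cos.fun_mul dv'))).congr_deriv ?_
      simp
      ring
    · refine ((du t).cosh.fun_mul du').congr_deriv ?_
      simp
      ring
  have hw0 : w ≠ 0 := hw ▸ (sqrt_pos.2 hnd).ne'
  have hw2 : speedSq ε (u t) (deriv u t) (deriv v t) = w ^ 2 := by rw [hw, sq_sqrt hnd.le]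
  rw [hd₂.deriv, hd₁, catenaryDefect, ← hw, hw2]
  simp only [det3, lprod, lcross, Psi, Pi.smul_apply, smul_eq_mul, Matrix.cons_val_zero,
    Matrix.cons_val_one, Matrix.cons_val]
  have h₁ := cos_sq_add_sin_sq (v t)
  have h₂ := cosh_sq (u t)
  generalize deriv (deriv u) t = u₂
  generalize deriv (deriv v) t = v₂
  generalize deriv u t = u₁
  generalize deriv v t = v₁
  generalize cosh (u t) = C at *
  generalize sinh (u t) = S at *
  generalize cos (v t) = c at *
  generalize sin (v t) = s at *
  field_simp
  linear_combination (-(C * s + lam) * ε *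
      (C * (C * v₁ * (u₁ ^ 2 * S + C * u₂) - C * u₁ * (2 * u₁ * v₁ * S + C * v₂))
        + S * ((2 * u₁ * v₁ * S + C * v₂) * S * u₁
          - C * v₁ * (C * u₁ ^ 2 + u₂ * S - C * v₁ ^ 2)))) * h₁
    - ((C * s + lam) * ε * (C * v₁ * u₂ - C * u₁ * v₂ - 2 * S * u₁ ^ 2 * v₁)
      + w ^ 2 * u₁ * c) * h₂

end Helpers

theorem hyperbolic_catenary_normal_characterization
    (a b lam : ℝ) (hab : a < b)
    (u v : ℝ → ℝ) (hu : ContDiff ℝ (⊤ : ℕ∞) u) (hv : ContDiff ℝ (⊤ : ℕ∞) v)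
    (ε : ℝ) (hε : ε = 1 ∨ ε = -1)
    (γ : ℝ → Fin 3 → ℝ) (hγ : ∀ t, γ t = Psi (u t) (v t))
    (sp : ℝ → ℝ)
    (hsp : ∀ t, sp t =
      Real.sqrt (ε * ((deriv v t) ^ 2 * Real.cosh (u t) ^ 2 - (deriv u t) ^ 2)))
    (hnd : ∀ t ∈ Set.Icc a b,
      0 < ε * ((deriv v t) ^ 2 * Real.cosh (u t) ^ 2 - (deriv u t) ^ 2))
    (κ : ℝ → ℝ)
    (hκ : ∀ t, κ t = ε * det3 (γ t) (deriv γ t) (deriv (deriv γ) t) / sp t ^ 3)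
    (n : ℝ → Fin 3 → ℝ) (hn : ∀ t, n t = (-(1 / sp t)) • lcross (γ t) (deriv γ t))
    (hd : ∀ t ∈ Set.Icc a b, 0 < Real.cosh (u t) * Real.sin (v t))
    (hne : ∀ t ∈ Set.Icc a b, Real.cosh (u t) * Real.sin (v t) + lam ≠ 0) :
    IsCritical (fun x y => Real.cosh x * Real.sin y + lam) ε u v a b ↔
      ∀ t ∈ Set.Icc a b,
        κ t = -lprod (n t) ![(0 : ℝ), 1, 0]
          / (Real.cosh (u t) * Real.sin (v t) + lam) := by
  have key : ∀ t ∈ Set.Icc a b, (κ t = -lprod (n t) ![(0 : ℝ), 1, 0]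
      / (Real.cosh (u t) * Real.sin (v t) + lam) ↔ catenaryDefect lam ε u v t = 0) := by
    intro t ht
    rw [catenaryDefect_eq hu hv hγ (hsp t) (hnd t ht), ← hκ, ← hn, eq_div_iff (hne t ht),
      eq_neg_iff_add_eq_zero, mul_comm]
  have hcrit : IsCritical (fun x y => Real.cosh x * Real.sin y + lam) ε u v a b ↔
      ∀ φ ψ : ℝ → ℝ, ContDiff ℝ (⊤ : ℕ∞) φ → ContDiff ℝ (⊤ : ℕ∞) ψ →
        φ a = 0 → φ b = 0 → ψ a = 0 → ψ b = 0 →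
        ∫ t in a..b, -ε * Real.cosh (u t) * (deriv u t * ψ t - deriv v t * φ t) *
          catenaryDefect lam ε u v t = 0 := by
    refine forall₂_congr fun φ ψ => forall₄_congr fun hφ hψ hφa hφb =>
      forall₂_congr fun hψa hψb => ?_
    rw [← integral_firstVariation hab.le hu hv hφ hψ hnd hφa hφb hψa hψb,
      ← (hasDerivAt_energy hab.le hu hv hφ hψ hnd).deriv]
    rfl
  rw [forall₂_congr key, hcrit]
  constructor
  · intro h
    have hu' : ContDiff ℝ (⊤ : ℕ∞) (deriv u) := hu.iterate_deriv 1
    have hv' : ContDiff ℝ (⊤ : ℕ∞) (deriv v) := hv.iterate_deriv 1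
    have cu := hu.continuous
    have cu' := hu'.continuous
    have cv' := hv'.continuous
    have hzero := eq_zero_on_Icc_of_integral_smooth_mul_eq_zero hab
      (f := fun t => -ε * Real.cosh (u t) * (deriv u t ^ 2 + deriv v t ^ 2) *
        catenaryDefect lam ε u v t)
      (ContinuousOn.mul (Continuous.continuousOn (by fun_prop))
        (continuousOn_catenaryDefect hu hv hnd)) (fun g hg hga hgb => by
        rw [← h (fun t => -(g t * deriv v t)) (fun t => g t * deriv u t) (hg.mul hv').neg
          (hg.mul hu') (by simp [hga]) (by simp [hgb]) (by simp [hga]) (by simp [hgb])]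
        congr 1
        funext t
        ring)
    intro t ht
    have hε0 : ε ≠ 0 := by rcases hε with rfl | rfl <;> norm_num
    have hpos : deriv u t ^ 2 + deriv v t ^ 2 ≠ 0 := by
      intro h0
      have h1 : deriv u t = 0 := by nlinarith [sq_nonneg (deriv u t), sq_nonneg (deriv v t)]
      have h2 : deriv v t = 0 := by nlinarith [sq_nonneg (deriv u t), sq_nonneg (deriv v t)]
      simpa [h1, h2] using hnd t ht
    exact (mul_eq_zero.1 (hzero t ht)).resolve_left
      (mul_ne_zero (mul_ne_zero (neg_ne_zero.2 hε0) (Real.cosh_pos _).ne') hpos)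
  · intro h φ ψ _ _ _ _ _ _
    refine intervalIntegral.integral_zero_ae (.of_forall fun t ht => ?_)
    rw [Set.uIoc_of_le hab.le] at ht
    rw [h t (Set.Ioc_subset_Icc_self ht), mul_zero]
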